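/- Let (Ω, F, P) be a nonatomic probability space, let Φ be an Orlicz function that is finite-valued, continuous and strictly increasing, and let H_Φ be the associated Orlicz premium on L∞₊. If H_Φ is cash-additive (H_Φ(X + h) = H_Φ(X) + h for every X ∈ L∞₊ and constant h ≥ 0) and convex, then there exist constants a ≥ b > 0 such that Φ(x) = 1 + a·(x−1)₊ − b·(x−1)₋ for all x ≥ 0; if instead H_Φ is cash-additive and concave, the same form holds with 0 < a ≤ b. -/

import Mathlib

open MeasureTheory Filter Set
open scoped ENNReal

noncomputable section

variable {Ω : Type*} [MeasurableSpace Ω]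

/-- `X` belongs to `L^∞_+(P)`: it is measurable, `P`-a.s. nonnegative and
`P`-essentially bounded. -/
def MemLinftyPlus (P : Measure Ω) (X : Ω → ℝ) : Prop :=
  Measurable X ∧ (∀ᵐ ω ∂P, 0 ≤ X ω) ∧ ∃ C : ℝ, ∀ᵐ ω ∂P, X ω ≤ C

/-- `X` belongs to `L^∞_++(P)`: it is measurable, bounded away from `0` and
`P`-essentially bounded. -/
def MemLinftyPlusPlus (P : Measure Ω) (X : Ω → ℝ) : Prop :=
  Measurable X ∧ (∃ c : ℝ, 0 < c ∧ ∀ᵐ ω ∂P, c ≤ X ω) ∧ ∃ C : ℝ, ∀ᵐ ω ∂P, X ω ≤ C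

/-- An Orlicz function `Φ : [0,∞) → ℝ ∪ {±∞}`: nondecreasing, left-continuous,
`Φ(x) > -∞` for `x > 0`, `Φ(x) ≤ 1` for `0 ≤ x ≤ 1` and `Φ(x) > 1` for `x > 1`. -/
structure IsOrliczFunction (Φ : ℝ → EReal) : Prop where
  ne_bot : ∀ x : ℝ, 0 < x → Φ x ≠ ⊥
  le_one : ∀ x : ℝ, 0 ≤ x → x ≤ 1 → Φ x ≤ 1
  one_lt : ∀ x : ℝ, 1 < x → 1 < Φ x
  mono : ∀ x y : ℝ, 0 ≤ x → x ≤ y → Φ x ≤ Φ y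
  left_cont : ∀ x : ℝ, 0 < x → Φ x = ⨆ y : Set.Ico (0 : ℝ) x, Φ (y : ℝ)

/-- The nonnegative part of an extended real, as an extended nonnegative real. -/
def erealToENNReal (x : EReal) : ℝ≥0∞ :=
  if x = ⊤ then ⊤ else ENNReal.ofReal x.toReal

/-- Expectation of an extended-real-valued function: positive part minus negative part. -/
def eexp (P : Measure Ω) (f : Ω → EReal) : EReal :=
  ((∫⁻ ω, erealToENNReal (f ω) ∂P : ℝ≥0∞) : EReal)
    - ((∫⁻ ω, erealToENNReal (-(f ω)) ∂P : ℝ≥0∞) : EReal)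

/-- The (generalized) Orlicz premium `H_Φ(X) = inf {k > 0 | E[Φ(X/k)] ≤ 1}`, with the
convention `H_Φ(X) = 0` if `Φ(0) = -∞` and `P(X = 0) > 0`. -/
def orliczPremium (P : Measure Ω) (Φ : ℝ → EReal) (X : Ω → ℝ) : ℝ :=
  if Φ 0 = ⊥ ∧ 0 < P {ω | X ω = 0} then 0
  else sInf {k : ℝ | 0 < k ∧ eexp P (fun ω => Φ (X ω / k)) ≤ 1}

/-- Addition on `EReal` with the convention `(-∞) + (+∞) = +∞`. -/
def eadd (a b : EReal) : EReal :=
  if (a = ⊥ ∧ b = ⊤) ∨ (a = ⊤ ∧ b = ⊥) then ⊤ else a + b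

/-- Multiplication on `ℝ≥0∞` with the convention `0 * ∞ = ∞`. -/
def gmulE (a b : ℝ≥0∞) : ℝ≥0∞ :=
  if (a = 0 ∧ b = ⊤) ∨ (a = ⊤ ∧ b = 0) then ⊤ else a * b

/-- Expectation of a finitely-valued composition. -/
lemma aux_eexp {ι : Type*} [Fintype ι] [MeasurableSpace ι] [DiscreteMeasurableSpace ι]
    (P : Measure Ω) [IsProbabilityMeasure P] (c : Ω → ι) (hc : Measurable c) (u : ι → ℝ) :
    eexp P (fun ω => ((u (c ω) : ℝ) : EReal)) =
      ((∑ i, P.real (c ⁻¹' {i}) * u i : ℝ) : EReal) := by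
  have key : ∀ w : ι → ℝ, (∫⁻ ω, erealToENNReal ((w (c ω) : ℝ) : EReal) ∂P)
      = ENNReal.ofReal (∑ i, P.real (c ⁻¹' {i}) * max (w i) 0) := by
    intro w
    have h1 : (∫⁻ ω, erealToENNReal ((w (c ω) : ℝ) : EReal) ∂P)
        = ∫⁻ i, ENNReal.ofReal (w i) ∂(P.map c) := by
      rw [lintegral_map (Measurable.of_discrete) hc]
      simp [erealToENNReal]
    rw [h1, lintegral_fintype, ENNReal.ofReal_sum_of_nonneg]
    · refine Finset.sum_congr rfl fun i _ => ?_
      rw [Measure.map_apply hc (MeasurableSet.of_discrete), mul_comm,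
        ENNReal.ofReal_mul measureReal_nonneg, ofReal_measureReal]
      congr 1
      rw [ENNReal.ofReal_max]; simp
    · intro i _
      exact mul_nonneg measureReal_nonneg (le_max_right _ _)
  unfold eexp
  have e2 : (fun ω => erealToENNReal (-((u (c ω) : ℝ) : EReal)))
      = fun ω => erealToENNReal (((fun i => - u i) (c ω) : ℝ) : EReal) := by
    funext ω; simp
  rw [e2, key u, key (fun i => - u i)]
  have nn : ∀ w : ι → ℝ, 0 ≤ ∑ i, P.real (c ⁻¹' {i}) * max (w i) 0 := fun w =>
    Finset.sum_nonneg fun i _ => mul_nonneg measureReal_nonneg (le_max_right _ _)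
  rw [EReal.coe_ennreal_ofReal, EReal.coe_ennreal_ofReal, max_eq_left (nn _),
    max_eq_left (nn _), ← EReal.coe_sub, ← Finset.sum_sub_distrib]
  congr 1
  refine Finset.sum_congr rfl fun i _ => ?_
  rw [← mul_sub]
  congr 1
  rcases le_total (u i) 0 with h | h
  · rw [max_eq_right h, max_eq_left (by linarith)]; ring
  · rw [max_eq_left h, max_eq_right (by linarith)]; ring

/-- The finite real representative. -/
structure AuxRep (Φ : ℝ → EReal) (φ : ℝ → ℝ) : Prop where
  eq : ∀ x, 0 ≤ x → Φ x = (φ x : EReal)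
  cont : Continuous φ
  mono : Monotone φ
  strict : StrictMonoOn φ (Set.Ici 0)
  one : φ 1 = 1

lemma aux_rep (Φ : ℝ → EReal) (hΦ : IsOrliczFunction Φ)
    (hfin : ∀ x : ℝ, 0 ≤ x → Φ x ≠ ⊥ ∧ Φ x ≠ ⊤)
    (hcont : ContinuousOn Φ (Set.Ici (0 : ℝ)))
    (hstrict : StrictMonoOn Φ (Set.Ici (0 : ℝ))) :
    ∃ φ, AuxRep Φ φ := by
  have hc : ∀ x : ℝ, 0 ≤ max x 0 := fun x => le_max_right _ _
  have heq : ∀ x, 0 ≤ x → Φ x = (((Φ (max x 0)).toReal : ℝ) : EReal) := by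
    intro x hx
    rw [max_eq_left hx, EReal.coe_toReal (hfin x hx).2 (hfin x hx).1]
  have hcont' : Continuous (fun x => (Φ (max x 0)).toReal) := by
    refine EReal.continuousOn_toReal.comp_continuous
      (hcont.comp_continuous (by fun_prop) (fun x => hc x)) ?_
    intro x
    have := hfin _ (hc x)
    simp [this.1, this.2]
  have hs : StrictMonoOn (fun x => (Φ (max x 0)).toReal) (Set.Ici 0) := by
    intro x hx y hy hxy
    have := hstrict hx hy hxy
    rw [heq x hx, heq y hy] at this
    exact_mod_cast this
  refine ⟨fun x => (Φ (max x 0)).toReal, heq, hcont', ?_, hs, ?_⟩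
  · intro x y hxy
    have h := hΦ.mono _ _ (hc x) (max_le_max_right 0 hxy)
    exact EReal.toReal_le_toReal h (hfin _ (hc x)).1 (hfin _ (hc y)).2
  · apply le_antisymm
    · have := hΦ.le_one 1 zero_le_one le_rfl
      rw [heq 1 zero_le_one] at this
      exact_mod_cast this
    · have h2 : Filter.Tendsto (fun x => (Φ (max x 0)).toReal) (nhdsWithin 1 (Set.Ioi 1))
          (nhds ((Φ (max 1 0)).toReal)) := (hcont'.tendsto 1).mono_left nhdsWithin_le_nhds
      refine ge_of_tendsto h2 ?_
      filter_upwards [self_mem_nhdsWithin] with x hx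
      have hx' : (1 : ℝ) < x := hx
      have := hΦ.one_lt x hx'
      rw [heq x (by linarith)] at this
      exact le_of_lt (by exact_mod_cast this)

section prem
variable {ι : Type*} [Fintype ι] [MeasurableSpace ι] [DiscreteMeasurableSpace ι]
  {P : Measure Ω} [IsProbabilityMeasure P] {Φ : ℝ → EReal} {φ : ℝ → ℝ}

/-- expectation functional -/
def auxE (P : Measure Ω) (φ : ℝ → ℝ) (c : Ω → ι) (v : ι → ℝ) (k : ℝ) : ℝ :=
  ∑ i, P.real (c ⁻¹' {i}) * φ (v i / k)

lemma aux_prem_eq (hr : AuxRep Φ φ) (c : Ω → ι) (hc : Measurable c) (v : ι → ℝ)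
    (hv : ∀ i, 0 ≤ v i) :
    orliczPremium P Φ (fun ω => v (c ω)) = sInf {k : ℝ | 0 < k ∧ auxE P φ c v k ≤ 1} := by
  unfold orliczPremium
  rw [if_neg (by rw [hr.eq 0 le_rfl]; simp)]
  congr 1
  ext k
  simp only [Set.mem_ofPred_eq]
  refine and_congr_right fun hk => ?_
  have : (fun ω => Φ (v (c ω) / k)) = fun ω => ((φ (v (c ω) / k) : ℝ) : EReal) := by
    funext ω; exact hr.eq _ (div_nonneg (hv _) hk.le)
  rw [this, aux_eexp P c hc (fun i => φ (v i / k))]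
  unfold auxE
  exact_mod_cast Iff.rfl

lemma aux_sum (c : Ω → ι) (hc : Measurable c) : ∑ i, P.real (c ⁻¹' {i}) = 1 := by
  have := aux_eexp P c hc (fun _ => (1 : ℝ))
  simp only [mul_one] at this
  have h2 : eexp P (fun _ : Ω => ((1 : ℝ) : EReal)) = 1 := by
    have e1 : erealToENNReal (1 : EReal) = 1 := by
      have : erealToENNReal ((1 : ℝ) : EReal) = 1 := by
        unfold erealToENNReal; rw [if_neg (EReal.coe_ne_top 1)]; simp
      simpa using this
    have e2 : erealToENNReal (-1 : EReal) = 0 := by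
      have : erealToENNReal ((-1 : ℝ) : EReal) = 0 := by
        unfold erealToENNReal; rw [if_neg (EReal.coe_ne_top _)]; simp
      simpa using this
    simp [eexp, e1, e2]
  rw [h2] at this
  exact_mod_cast this.symm

lemma aux_anti (hr : AuxRep Φ φ) (c : Ω → ι) (v : ι → ℝ) (hv : ∀ i, 0 ≤ v i) {k l : ℝ}
    (hk : 0 < k) (hkl : k ≤ l) : auxE P φ c v l ≤ auxE P φ c v k := by
  unfold auxE
  refine Finset.sum_le_sum fun i _ => mul_le_mul_of_nonneg_left (hr.mono ?_) measureReal_nonneg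
  exact div_le_div_of_nonneg_left (hv i) hk hkl

lemma aux_cont (hr : AuxRep Φ φ) (c : Ω → ι) (v : ι → ℝ) {k : ℝ} (hk : 0 < k) :
    ContinuousAt (auxE P φ c v) k := by
  unfold auxE
  have : ∀ i, ContinuousAt (fun k => φ (v i / k)) k := fun i =>
    ContinuousAt.comp (hr.cont.continuousAt) (continuousAt_const.div continuousAt_id hk.ne')
  exact tendsto_finset_sum _ fun i _ => (this i).tendsto.const_mul _

lemma aux_nonempty (hr : AuxRep Φ φ) (c : Ω → ι) (hc : Measurable c) (v : ι → ℝ)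
    (hv : ∀ i, 0 ≤ v i) : {k : ℝ | 0 < k ∧ auxE P φ c v k ≤ 1}.Nonempty := by
  have hs : 0 ≤ ∑ i, v i := Finset.sum_nonneg fun i _ => hv i
  refine ⟨1 + ∑ i, v i, by linarith, ?_⟩
  unfold auxE
  refine le_trans (Finset.sum_le_sum fun i _ => ?_) (aux_sum (P := P) c hc).le
  have h1 : φ (v i / (1 + ∑ i, v i)) ≤ 1 := by
    refine le_trans (hr.mono ?_) hr.one.le
    rw [div_le_one (by linarith)]
    have := Finset.single_le_sum (f := v) (fun i _ => hv i) (Finset.mem_univ i)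
    linarith
  nlinarith [measureReal_nonneg (μ := P) (s := c ⁻¹' {i})]

lemma aux_bdd (c : Ω → ι) (v : ι → ℝ) : BddBelow {k : ℝ | 0 < k ∧ auxE P φ c v k ≤ 1} :=
  ⟨0, fun _ h => h.1.le⟩

lemma aux_le (hr : AuxRep Φ φ) (c : Ω → ι) (hc : Measurable c) (v : ι → ℝ)
    (hv : ∀ i, 0 ≤ v i) {K : ℝ} (hK : 0 < K)
    (h : orliczPremium P Φ (fun ω => v (c ω)) ≤ K) : auxE P φ c v K ≤ 1 := by
  rw [aux_prem_eq hr c hc v hv] at h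
  have h2 : Filter.Tendsto (auxE P φ c v) (nhdsWithin K (Set.Ioi K))
      (nhds (auxE P φ c v K)) := (aux_cont hr c v hK).tendsto.mono_left nhdsWithin_le_nhds
  refine le_of_tendsto h2 ?_
  filter_upwards [self_mem_nhdsWithin] with k hk
  have hk' : K < k := hk
  obtain ⟨l, hl, hlk⟩ := exists_lt_of_csInf_lt (aux_nonempty hr c hc v hv) (lt_of_le_of_lt h hk')
  exact (aux_anti hr c v hv hl.1 hlk.le).trans hl.2

lemma aux_ge (hr : AuxRep Φ φ) (c : Ω → ι) (hc : Measurable c) (v : ι → ℝ)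
    (hv : ∀ i, 0 ≤ v i) {K : ℝ} (hK : 0 < K)
    (h : K ≤ orliczPremium P Φ (fun ω => v (c ω))) : 1 ≤ auxE P φ c v K := by
  rw [aux_prem_eq hr c hc v hv] at h
  have h2 : Filter.Tendsto (auxE P φ c v) (nhdsWithin K (Set.Iio K))
      (nhds (auxE P φ c v K)) := (aux_cont hr c v hK).tendsto.mono_left nhdsWithin_le_nhds
  refine ge_of_tendsto h2 ?_
  filter_upwards [Ioo_mem_nhdsLT hK] with k hk
  by_contra hcon
  push Not at hcon
  have := csInf_le (aux_bdd (P := P) (φ := φ) c v) (show k ∈ _ from ⟨hk.1, hcon.le⟩)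
  linarith [hk.2]

lemma aux_eq_one (hr : AuxRep Φ φ) (c : Ω → ι) (hc : Measurable c) (v : ι → ℝ)
    (hv : ∀ i, 0 ≤ v i) (h : ∑ i, P.real (c ⁻¹' {i}) * φ (v i) = 1) :
    orliczPremium P Φ (fun ω => v (c ω)) = 1 := by
  rw [aux_prem_eq hr c hc v hv]
  apply le_antisymm
  · exact csInf_le (aux_bdd c v) ⟨one_pos, by simp [auxE, h]⟩
  · refine le_csInf (aux_nonempty hr c hc v hv) ?_
    rintro k ⟨hk, hE⟩
    by_contra hk1
    push Not at hk1
    have hle : ∀ i, v i ≤ v i / k := fun i => by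
      rw [le_div_iff₀ hk]; nlinarith [hv i]
    have hterm : ∀ i ∈ Finset.univ, P.real (c ⁻¹' {i}) * φ (v i)
        ≤ P.real (c ⁻¹' {i}) * φ (v i / k) := fun i _ =>
      mul_le_mul_of_nonneg_left (hr.mono (hle i)) measureReal_nonneg
    have heq : ∑ i, P.real (c ⁻¹' {i}) * φ (v i) = ∑ i, P.real (c ⁻¹' {i}) * φ (v i / k) :=
      le_antisymm (Finset.sum_le_sum hterm) (by rw [h]; exact hE)
    rw [Finset.sum_eq_sum_iff_of_le hterm] at heq
    have h0 : ∀ i, P.real (c ⁻¹' {i}) * φ (v i) = P.real (c ⁻¹' {i}) * φ 0 := by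
      intro i
      have hi := heq i (Finset.mem_univ i)
      rcases (hv i).eq_or_lt with h0 | h0
      · rw [← h0]
      · have hlt : φ (v i) < φ (v i / k) := by
          apply hr.strict (hv i) (div_nonneg (hv i) hk.le)
          rw [lt_div_iff₀ hk]; nlinarith
        rcases mul_eq_mul_left_iff.1 hi with hh | hh
        · linarith
        · rw [hh]; simp
    rw [Finset.sum_congr rfl (fun i _ => h0 i), ← Finset.sum_mul, aux_sum c hc] at h
    have := hr.strict (Set.mem_Ici.2 le_rfl) (Set.mem_Ici.2 zero_le_one) (zero_lt_one' ℝ)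
    rw [hr.one] at this
    linarith

lemma aux_mem (c : Ω → ι) (hc : Measurable c) (v : ι → ℝ)
    (hv : ∀ i, 0 ≤ v i) : MemLinftyPlus P (fun ω => v (c ω)) := by
  refine ⟨(Measurable.of_discrete (f := v)).comp hc, ae_of_all _ fun ω => hv _,
    ∑ i, v i, ae_of_all _ fun ω => ?_⟩
  exact Finset.single_le_sum (f := v) (fun i _ => hv i) (Finset.mem_univ _)

/-- Cash-additivity on finitely valued variables. -/
lemma aux_cash (hr : AuxRep Φ φ)
    (hca : ∀ X : Ω → ℝ, MemLinftyPlus P X → ∀ h : ℝ, 0 ≤ h →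
      orliczPremium P Φ (fun ω => X ω + h) = orliczPremium P Φ X + h)
    (c : Ω → ι) (hc : Measurable c) (v : ι → ℝ)
    (hv : ∀ i, 0 ≤ v i) (h : ∑ i, P.real (c ⁻¹' {i}) * φ (v i) = 1) (t : ℝ) (ht : 0 ≤ t) :
    ∑ i, P.real (c ⁻¹' {i}) * φ ((v i + t) / (1 + t)) = 1 := by
  have h1 := hca _ (aux_mem c hc v hv) t ht
  rw [aux_eq_one hr c hc v hv h] at h1
  have hv' : ∀ i, 0 ≤ v i + t := fun i => add_nonneg (hv i) ht
  exact le_antisymm (aux_le hr c hc (fun i => v i + t) hv' (by linarith) h1.le)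
    (aux_ge hr c hc (fun i => v i + t) hv' (by linarith) h1.ge)

lemma aux_convex (hr : AuxRep Φ φ)
    (hcv : ∀ X Y : Ω → ℝ, MemLinftyPlus P X → MemLinftyPlus P Y →
        ∀ a ∈ Set.Ioo (0 : ℝ) 1,
          orliczPremium P Φ (fun ω => a * X ω + (1 - a) * Y ω) ≤
            a * orliczPremium P Φ X + (1 - a) * orliczPremium P Φ Y)
    (c : Ω → ι) (hc : Measurable c) (v w : ι → ℝ)
    (hv : ∀ i, 0 ≤ v i) (hw : ∀ i, 0 ≤ w i)
    (h : ∑ i, P.real (c ⁻¹' {i}) * φ (v i) = 1) (h' : ∑ i, P.real (c ⁻¹' {i}) * φ (w i) = 1) :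
    ∑ i, P.real (c ⁻¹' {i}) * φ ((v i + w i) / 2) ≤ 1 := by
  have h1 := hcv _ _ (aux_mem c hc v hv) (aux_mem c hc w hw) (1/2) (by norm_num)
  rw [aux_eq_one hr c hc v hv h, aux_eq_one hr c hc w hw h'] at h1
  have := aux_le (P := P) hr c hc (fun i => 1/2 * v i + (1 - 1/2) * w i)
    (fun i => by have := hv i; have := hw i; norm_num; linarith) one_pos (by linarith)
  simp only [auxE, div_one] at this
  convert this using 4
  ring

lemma aux_concave (hr : AuxRep Φ φ)
    (hcv : ∀ X Y : Ω → ℝ, MemLinftyPlus P X → MemLinftyPlus P Y →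
        ∀ a ∈ Set.Ioo (0 : ℝ) 1,
          a * orliczPremium P Φ X + (1 - a) * orliczPremium P Φ Y ≤
            orliczPremium P Φ (fun ω => a * X ω + (1 - a) * Y ω))
    (c : Ω → ι) (hc : Measurable c) (v w : ι → ℝ)
    (hv : ∀ i, 0 ≤ v i) (hw : ∀ i, 0 ≤ w i)
    (h : ∑ i, P.real (c ⁻¹' {i}) * φ (v i) = 1) (h' : ∑ i, P.real (c ⁻¹' {i}) * φ (w i) = 1) :
    1 ≤ ∑ i, P.real (c ⁻¹' {i}) * φ ((v i + w i) / 2) := by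
  have h1 := hcv _ _ (aux_mem c hc v hv) (aux_mem c hc w hw) (1/2) (by norm_num)
  rw [aux_eq_one hr c hc v hv h, aux_eq_one hr c hc w hw h'] at h1
  have := aux_ge (P := P) hr c hc (fun i => 1/2 * v i + (1 - 1/2) * w i)
    (fun i => by have := hv i; have := hw i; norm_num; linarith) one_pos (by linarith)
  simp only [auxE, div_one] at this
  convert this using 4
  ring

end prem

/-- Continuous multiplicative functions are powers. -/
lemma aux_pow (F : ℝ → ℝ) (hF : Continuous F) (hpos : ∀ s, 0 < s → 0 < F s)
    (hmul : ∀ l s, 0 < l → l ≤ 1 → 0 < s → F (l * s) = F l * F s) :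
    ∃ r : ℝ, ∀ s, 0 < s → F s = s ^ r := by
  have h1 : F 1 = 1 := by
    have := hmul 1 1 one_pos le_rfl one_pos
    have h := hpos 1 one_pos
    rw [one_mul] at this
    nlinarith
  have hm : ∀ l s, 0 < l → 0 < s → F (l * s) = F l * F s := by
    intro l s hl hs
    rcases le_total l 1 with h | h
    · exact hmul l s hl h hs
    · have hi : l⁻¹ ≤ 1 := inv_le_one_of_one_le₀ h
      have hi' : 0 < l⁻¹ := inv_pos.2 hl
      have a1 := hmul l⁻¹ (l * s) hi' hi (mul_pos hl hs)
      have a2 := hmul l⁻¹ l hi' hi hl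
      rw [inv_mul_cancel₀ hl.ne', h1] at a2
      rw [inv_mul_cancel_left₀ hl.ne'] at a1
      rw [a1, ← mul_assoc, mul_comm (F l), ← a2, one_mul]
  let L : ℝ →+ ℝ := AddMonoidHom.mk' (fun x => Real.log (F (Real.exp x))) (by
    intro x y
    rw [Real.exp_add, hm _ _ (Real.exp_pos _) (Real.exp_pos _),
      Real.log_mul (hpos _ (Real.exp_pos _)).ne' (hpos _ (Real.exp_pos _)).ne'])
  have hL : Continuous L := by
    change Continuous (fun x => Real.log (F (Real.exp x)))
    exact Continuous.log (hF.comp Real.continuous_exp) fun x => (hpos _ (Real.exp_pos _)).ne'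
  refine ⟨L 1, fun s hs => ?_⟩
  have h2 := map_real_smul L hL (Real.log s) 1
  simp only [smul_eq_mul, mul_one] at h2
  have h3 : L (Real.log s) = Real.log (F s) := by
    change Real.log (F (Real.exp (Real.log s))) = _
    rw [Real.exp_log hs]
  rw [Real.rpow_def_of_pos hs, ← h2, h3, Real.exp_log (hpos s hs)]

/-- The power form. -/
lemma aux_form {P : Measure Ω} [IsProbabilityMeasure P] {Φ : ℝ → EReal} {φ : ℝ → ℝ}
    (hP : ∀ p : ℝ, 0 ≤ p → p ≤ 1 →
      ∃ A : Set Ω, MeasurableSet A ∧ P A = ENNReal.ofReal p)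
    (hr : AuxRep Φ φ)
    (hca : ∀ X : Ω → ℝ, MemLinftyPlus P X → ∀ h : ℝ, 0 ≤ h →
      orliczPremium P Φ (fun ω => X ω + h) = orliczPremium P Φ X + h) :
    ∃ a b r : ℝ, 0 < a ∧ 0 < b ∧ r ≠ 0 ∧ (∀ s, 0 ≤ s → φ (1 + s) = 1 + a * s ^ r) ∧
      (∀ t, 0 ≤ t → t ≤ 1 → φ (1 - t) = 1 - b * t ^ r) := by
  have hf : ∀ s, 0 < s → 0 < φ (1 + s) - 1 := by
    intro s hs
    have := hr.strict (Set.mem_Ici.2 zero_le_one) (Set.mem_Ici.2 (by linarith : (0:ℝ) ≤ 1 + s))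
      (by linarith : (1:ℝ) < 1 + s)
    rw [hr.one] at this; linarith
  have hg : ∀ t, 0 < t → t ≤ 1 → 0 < 1 - φ (1 - t) := by
    intro s hs hs1
    have := hr.strict (Set.mem_Ici.2 (by linarith : (0:ℝ) ≤ 1 - s)) (Set.mem_Ici.2 zero_le_one)
      (by linarith : 1 - s < 1)
    rw [hr.one] at this; linarith
  have key : ∀ s t l, 0 < s → 0 < t → t ≤ 1 → 0 < l → l ≤ 1 →
      (φ (1 + s) - 1) * (1 - φ (1 - l * t)) = (φ (1 + l * s) - 1) * (1 - φ (1 - t)) := by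
    intro s t l hs ht ht1 hl hl1
    have h1 := hf s hs
    have h2 := hg t ht ht1
    set f := φ (1 + s) - 1 with hfdef
    set g := 1 - φ (1 - t) with hgdef
    have hfg : 0 < f + g := by linarith
    obtain ⟨A, hA, hPA⟩ := hP (g / (f + g)) (by positivity) (by rw [div_le_one hfg]; linarith)
    classical
    let c : Ω → Bool := fun ω => decide (ω ∈ A)
    have hc : Measurable c := by
      apply measurable_to_bool
      have : c ⁻¹' {true} = A := by ext; simp [c]
      rw [this]; exact hA
    have hct : c ⁻¹' {true} = A := by ext; simp [c]
    have hqt : P.real (c ⁻¹' {true}) = g / (f + g) := by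
      rw [hct, measureReal_def, hPA, ENNReal.toReal_ofReal (by positivity)]
    have hsum := aux_sum (P := P) c hc
    simp only [Fintype.sum_bool] at hsum
    have hqf : P.real (c ⁻¹' {false}) = f / (f + g) := by
      have : f / (f + g) = 1 - g / (f + g) := by field_simp; ring
      linarith
    have hx := aux_cash hr hca c hc (fun b => if b then 1 + s else 1 - t)
      (by intro b; cases b <;> simp <;> linarith) (by
        simp only [Fintype.sum_bool, hqt, hqf]
        have e1 : φ (1 + s) = 1 + f := by rw [hfdef]; ring
        have e2 : φ (1 - t) = 1 - g := by rw [hgdef]; ring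
        simp [e1, e2]
        field_simp; ring) (l⁻¹ - 1) (by
          have := one_le_inv_iff₀.2 ⟨hl, hl1⟩; linarith)
    simp only [Fintype.sum_bool, hqt, hqf] at hx
    have e1 : (1 + s + (l⁻¹ - 1)) / (1 + (l⁻¹ - 1)) = 1 + l * s := by field_simp; ring
    have e2 : (1 - t + (l⁻¹ - 1)) / (1 + (l⁻¹ - 1)) = 1 - l * t := by field_simp; ring
    simp only [if_true, Bool.false_eq_true, if_false] at hx
    rw [e1, e2] at hx
    field_simp at hx
    linarith
  have ha := hf 1 one_pos
  have hb := hg 1 one_pos le_rfl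
  set a := φ (1 + 1) - 1 with hadef
  set b := 1 - φ (1 - 1) with hbdef
  have hgt : ∀ t, 0 < t → t ≤ 1 → a * (1 - φ (1 - t)) = (φ (1 + t) - 1) * b := by
    intro t ht ht1
    have := key 1 1 t one_pos one_pos le_rfl ht ht1
    rwa [mul_one] at this
  obtain ⟨r, hrp⟩ := aux_pow (fun s => (φ (1 + s) - 1) / a)
    (by have := hr.cont; fun_prop) (fun s hs => div_pos (hf s hs) ha) (by
      intro l s hl hl1 hs
      have k1 := key s 1 l hs one_pos le_rfl hl hl1
      rw [mul_one] at k1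
      have k2 := hgt l hl hl1
      have : a * b * (φ (1 + l * s) - 1) = b * ((φ (1 + l) - 1) * (φ (1 + s) - 1)) := by
        rw [mul_comm a b, mul_assoc, mul_comm a]
        linear_combination (-a) * k1 + (φ (1 + s) - 1) * k2
      have h3 : a * (φ (1 + l * s) - 1) = ((φ (1 + l) - 1) * (φ (1 + s) - 1)) := by
        apply mul_left_cancel₀ hb.ne'; linarith
      field_simp
      linarith)
  have hfs : ∀ s, 0 < s → φ (1 + s) = 1 + a * s ^ r := by
    intro s hs
    have := hrp s hs
    rw [div_eq_iff ha.ne'] at this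
    linarith
  have hr0 : r ≠ 0 := by
    rintro rfl
    have h1 := hfs 1 one_pos
    have h2 := hfs 2 two_pos
    have := hr.strict (Set.mem_Ici.2 (by norm_num : (0:ℝ) ≤ 1 + 1))
      (Set.mem_Ici.2 (by norm_num : (0:ℝ) ≤ 1 + 2)) (by norm_num)
    rw [h1, h2] at this
    simp at this
  refine ⟨a, b, r, ha, hb, hr0, ?_, ?_⟩
  · intro s hs
    rcases hs.eq_or_lt with h | h
    · rw [← h, Real.zero_rpow hr0]; simp [hr.one]
    · exact hfs s h
  · intro t ht ht1
    rcases ht.eq_or_lt with h | h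
    · rw [← h, Real.zero_rpow hr0]; simp [hr.one]
    · have k := hgt t h ht1
      rw [hfs t h] at k
      have : a * (1 - φ (1 - t)) = a * (b * t ^ r) := by rw [k]; ring
      have := mul_left_cancel₀ ha.ne' this
      linarith

/-- Three-point test. -/
lemma aux_three (φ : ℝ → ℝ) (q : Fin 3 → ℝ) (hq : ∀ i, 0 < q i) (hsum : ∑ i, q i = 1)
    (κ κ' r σ : ℝ) (hκ : 0 < κ) (hκ' : 0 < κ') (hr : r ≠ 0) (hσ : σ = 1 ∨ σ = -1)
    (h1 : ∀ d, 0 ≤ d → d ≤ 1 → φ (1 + σ * d) = 1 + σ * κ * d ^ r)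
    (h2 : ∀ d, 0 ≤ d → d ≤ 1 → φ (1 - σ * d) = 1 - σ * κ' * d ^ r) :
    ∃ v w : Fin 3 → ℝ, (∀ i, 0 ≤ v i) ∧ (∀ i, 0 ≤ w i) ∧ ∑ i, q i * φ (v i) = 1 ∧
      ∑ i, q i * φ (w i) = 1 ∧ ∃ C : ℝ, 0 < C ∧
      ∑ i, q i * φ ((v i + w i) / 2) = 1 + σ * (C * (2 - 2 ^ r)) := by
  have q0 := hq 0
  have q1 := hq 1
  have q2 := hq 2
  have key : ∀ x : ℝ, 0 < x → (x ^ (1 / r)) ^ r = x := fun x hx => by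
    rw [← Real.rpow_mul hx.le, one_div_mul_cancel hr, Real.rpow_one]
  have kA := key (q 0)⁻¹ (by positivity)
  have kB := key (q 1)⁻¹ (by positivity)
  have kW := key (κ / (κ' * q 2)) (by positivity)
  have hA : 0 < (q 0)⁻¹ ^ (1 / r) := by positivity
  have hB : 0 < (q 1)⁻¹ ^ (1 / r) := by positivity
  have hW : 0 < (κ / (κ' * q 2)) ^ (1 / r) := by positivity
  set A := (q 0)⁻¹ ^ (1 / r)
  set B := (q 1)⁻¹ ^ (1 / r)
  set W := (κ / (κ' * q 2)) ^ (1 / r)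
  obtain ⟨e, he, heA, heB, heW⟩ : ∃ e : ℝ, 0 < e ∧ 2 * (A * e) ≤ 1 ∧ 2 * (B * e) ≤ 1 ∧
      2 * (W * e) ≤ 1 := by
    have hs : 0 < 2 * (A + B + W) := by positivity
    refine ⟨(2 * (A + B + W))⁻¹, by positivity, ?_, ?_, ?_⟩ <;>
    · rw [← mul_assoc, ← div_eq_mul_inv, div_le_one hs]; linarith
  have hAe : 0 < A * e := by positivity
  have hBe : 0 < B * e := by positivity
  have hWe : 0 < W * e := by positivity
  have pw : ∀ x : ℝ, 0 < x → (2 * (x * e)) ^ r = 2 ^ r * (x ^ r * e ^ r) := fun x hx => by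
    rw [Real.mul_rpow (by norm_num) (by positivity), Real.mul_rpow hx.le he.le]
  have pw1 : ∀ x : ℝ, 0 < x → (x * e) ^ r = x ^ r * e ^ r := fun x hx =>
    Real.mul_rpow hx.le he.le
  have nn : ∀ d : ℝ, 0 ≤ d → d ≤ 1 → 0 ≤ 1 + σ * d ∧ 0 ≤ 1 - σ * d := by
    intro d hd hd1
    rcases hσ with rfl | rfl <;> constructor <;> linarith
  have f1 : φ 1 = 1 := by
    have := h1 0 le_rfl zero_le_one
    rw [Real.zero_rpow hr] at this
    simpa using this
  have fA := h1 (2 * (A * e)) (by positivity) heA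
  have fB := h1 (2 * (B * e)) (by positivity) heB
  have fW := h2 (2 * (W * e)) (by positivity) heW
  have fA' := h1 (A * e) (by positivity) (by linarith)
  have fB' := h1 (B * e) (by positivity) (by linarith)
  rw [pw A hA, kA] at fA
  rw [pw B hB, kB] at fB
  rw [pw W hW, kW] at fW
  rw [pw1 A hA, kA] at fA'
  rw [pw1 B hB, kB] at fB'
  rw [Fin.sum_univ_three] at hsum
  have hE : 0 < e ^ r := Real.rpow_pos_of_pos he r
  refine ⟨![1 + σ * (2 * (A * e)), 1, 1 - σ * (2 * (W * e))],
    ![1, 1 + σ * (2 * (B * e)), 1 - σ * (2 * (W * e))], ?_, ?_, ?_, ?_, κ * e ^ r,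
    by positivity, ?_⟩
  · intro i
    fin_cases i
    · exact (nn _ (by positivity) heA).1
    · exact zero_le_one
    · exact (nn _ (by positivity) heW).2
  · intro i
    fin_cases i
    · exact zero_le_one
    · exact (nn _ (by positivity) heB).1
    · exact (nn _ (by positivity) heW).2
  · simp only [Fin.sum_univ_three, Matrix.cons_val]
    rw [fA, f1, fW]
    field_simp
    linear_combination hsum
  · simp only [Fin.sum_univ_three, Matrix.cons_val]
    rw [fB, f1, fW]
    field_simp
    linear_combination hsum
  · simp only [Fin.sum_univ_three, Matrix.cons_val]
    have z1 : (1 + σ * (2 * (A * e)) + 1) / 2 = 1 + σ * (A * e) := by ring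
    have z2 : (1 + (1 + σ * (2 * (B * e)))) / 2 = 1 + σ * (B * e) := by ring
    have z3 : (1 - σ * (2 * (W * e)) + (1 - σ * (2 * (W * e)))) / 2
      = 1 - σ * (2 * (W * e)) := by ring
    rw [z1, z2, z3, fA', fB', fW]
    field_simp
    linear_combination hsum

/-- A three-set partition into sets of positive probability. -/
lemma aux_partition {P : Measure Ω} [IsProbabilityMeasure P]
    (hP : ∀ p : ℝ, 0 ≤ p → p ≤ 1 →
      ∃ A : Set Ω, MeasurableSet A ∧ P A = ENNReal.ofReal p) :
    ∃ c : Ω → Fin 3, Measurable c ∧ ∀ i, 0 < P.real (c ⁻¹' {i}) := by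
  classical
  have main : ∀ A B : Set Ω, MeasurableSet A → MeasurableSet B →
      0 < P.real (A ∩ B) → 0 < P.real (A \ B) → 0 < P.real Aᶜ →
      ∃ c : Ω → Fin 3, Measurable c ∧ ∀ i, 0 < P.real (c ⁻¹' {i}) := by
    intro A B hA hB h0 h1 h2
    refine ⟨fun ω => if ω ∈ A then (if ω ∈ B then 0 else 1) else 2,
      Measurable.ite hA (Measurable.ite hB measurable_const measurable_const)
        measurable_const, ?_⟩
    intro i
    fin_cases i
    · convert h0 using 2
      ext ω; by_cases hA : ω ∈ A <;> by_cases hB : ω ∈ B <;> simp [hA, hB]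
    · convert h1 using 2
      ext ω; by_cases hA : ω ∈ A <;> by_cases hB : ω ∈ B <;> simp [hA, hB]
    · convert h2 using 2
      ext ω; by_cases hA : ω ∈ A <;> by_cases hB : ω ∈ B <;> simp [hA, hB]
  obtain ⟨A, hA, hPA⟩ := hP (1/2) (by norm_num) (by norm_num)
  obtain ⟨B, hB, hPB⟩ := hP (1/4) (by norm_num) (by norm_num)
  have rA : P.real A = 1/2 := by
    rw [measureReal_def, hPA, ENNReal.toReal_ofReal (by norm_num)]
  have rB : P.real B = 1/4 := by
    rw [measureReal_def, hPB, ENNReal.toReal_ofReal (by norm_num)]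
  have rAc : P.real Aᶜ = 1/2 := by
    rw [probReal_compl_eq_one_sub hA, rA]; norm_num
  have s1 : P.real (A ∩ B) + P.real (A \ B) = P.real A := measureReal_inter_add_sdiff hB
  have s2 : P.real (Aᶜ ∩ B) + P.real (Aᶜ \ B) = P.real Aᶜ := measureReal_inter_add_sdiff hB
  have s3 : P.real (B ∩ A) + P.real (B \ A) = P.real B := measureReal_inter_add_sdiff hA
  have e : B \ A = Aᶜ ∩ B := by ext; simp [and_comm]
  rw [e, Set.inter_comm B A] at s3
  have n1 : 0 ≤ P.real (A ∩ B) := measureReal_nonneg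
  have n2 : 0 ≤ P.real (Aᶜ ∩ B) := measureReal_nonneg
  rcases n1.eq_or_lt with h | h
  · exact main Aᶜ B hA.compl hB (by linarith) (by linarith) (by rw [compl_compl]; linarith)
  · exact main A B hA hB h (by linarith) (by linarith)

/-- on a nonatomic probability space, with `Φ` finite, continuous and
strictly increasing: if `H_Φ` is cash-additive and convex then
`Φ(x) = 1 + a(x-1)₊ - b(x-1)₋` with `a ≥ b > 0`; if `H_Φ` is cash-additive and
concave the same holds with `0 < a ≤ b`. -/
theorem orliczPremium_cashAdditive_convex_concave
    (P : Measure Ω) [IsProbabilityMeasure P]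
    (hP : ∀ p : ℝ, 0 ≤ p → p ≤ 1 →
      ∃ A : Set Ω, MeasurableSet A ∧ P A = ENNReal.ofReal p)
    (Φ : ℝ → EReal) (hΦ : IsOrliczFunction Φ)
    (hfin : ∀ x : ℝ, 0 ≤ x → Φ x ≠ ⊥ ∧ Φ x ≠ ⊤)
    (hcont : ContinuousOn Φ (Set.Ici (0 : ℝ)))
    (hstrict : StrictMonoOn Φ (Set.Ici (0 : ℝ)))
    (hca : ∀ X : Ω → ℝ, MemLinftyPlus P X → ∀ h : ℝ, 0 ≤ h →
      orliczPremium P Φ (fun ω => X ω + h) = orliczPremium P Φ X + h) :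
    ((∀ X Y : Ω → ℝ, MemLinftyPlus P X → MemLinftyPlus P Y →
        ∀ a ∈ Set.Ioo (0 : ℝ) 1,
          orliczPremium P Φ (fun ω => a * X ω + (1 - a) * Y ω) ≤
            a * orliczPremium P Φ X + (1 - a) * orliczPremium P Φ Y) →
      ∃ a b : ℝ, 0 < b ∧ b ≤ a ∧
        ∀ x : ℝ, 0 ≤ x →
          Φ x = ((1 + a * max (x - 1) 0 - b * max (1 - x) 0 : ℝ) : EReal)) ∧
    ((∀ X Y : Ω → ℝ, MemLinftyPlus P X → MemLinftyPlus P Y →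
        ∀ a ∈ Set.Ioo (0 : ℝ) 1,
          a * orliczPremium P Φ X + (1 - a) * orliczPremium P Φ Y ≤
            orliczPremium P Φ (fun ω => a * X ω + (1 - a) * Y ω)) →
      ∃ a b : ℝ, 0 < a ∧ a ≤ b ∧
        ∀ x : ℝ, 0 ≤ x →
          Φ x = ((1 + a * max (x - 1) 0 - b * max (1 - x) 0 : ℝ) : EReal)) := by
  obtain ⟨φ, hr⟩ := aux_rep Φ hΦ hfin hcont hstrict
  obtain ⟨a, b, r, ha, hb, hr0, hR, hL⟩ := aux_form hP hr hca
  obtain ⟨c, hc, hq⟩ := aux_partition hP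
  have hsum := aux_sum (P := P) c hc
  obtain ⟨v1, w1, hv1, hw1, hv1', hw1', C1, hC1, hE1⟩ :=
    aux_three φ (fun i => P.real (c ⁻¹' {i})) hq hsum a b r 1 ha hb hr0 (Or.inl rfl)
      (by intro d hd _; rw [one_mul, one_mul]; exact hR d hd)
      (by intro d hd hd1; rw [one_mul, one_mul]; exact hL d hd hd1)
  obtain ⟨v2, w2, hv2, hw2, hv2', hw2', C2, hC2, hE2⟩ :=
    aux_three φ (fun i => P.real (c ⁻¹' {i})) hq hsum b a r (-1) hb ha hr0 (Or.inr rfl)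
      (by intro d hd hd1
          have := hL d hd hd1
          rw [show 1 + -1 * d = 1 - d by ring, this]; ring)
      (by intro d hd _
          have := hR d hd
          rw [show 1 - -1 * d = 1 + d by ring, this]; ring)
  have fin : r = 1 → ∀ x : ℝ, 0 ≤ x →
      Φ x = ((1 + a * max (x - 1) 0 - b * max (1 - x) 0 : ℝ) : EReal) := by
    rintro rfl x hx
    rw [hr.eq x hx]
    congr 1
    rcases le_total x 1 with h | h
    · rw [max_eq_right (by linarith), max_eq_left (by linarith)]
      have := hL (1 - x) (by linarith) (by linarith)
      rw [sub_sub_cancel, Real.rpow_one] at this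
      rw [this]; ring
    · rw [max_eq_left (by linarith), max_eq_right (by linarith)]
      have := hR (x - 1) (by linarith)
      rw [add_sub_cancel, Real.rpow_one] at this
      rw [this]; ring
  have r1 : (2 : ℝ) ^ r = 2 → r = 1 := by
    intro h
    have h' := congrArg Real.log h
    rw [Real.log_rpow two_pos] at h'
    have := Real.log_pos one_lt_two
    exact mul_right_cancel₀ this.ne' (by rw [h', one_mul])
  -- the two-point test
  obtain ⟨A, hA, hPA⟩ := hP (1/2) (by norm_num) (by norm_num)
  classical
  let d : Ω → Bool := fun ω => decide (ω ∈ A)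
  have hdt : d ⁻¹' {true} = A := by ext; simp [d]
  have hd : Measurable d := by
    apply measurable_to_bool
    rw [hdt]; exact hA
  have hqt : P.real (d ⁻¹' {true}) = 1 / 2 := by
    rw [hdt, measureReal_def, hPA, ENNReal.toReal_ofReal (by norm_num)]
  have hsum2 := aux_sum (P := P) d hd
  simp only [Fintype.sum_bool] at hsum2
  have hqf : P.real (d ⁻¹' {false}) = 1 / 2 := by linarith
  have hab : 0 < a + b := by linarith
  have hs0 : 0 ≤ b / (a + b) := by positivity
  have ht0 : 0 ≤ a / (a + b) := by positivity
  have ht1 : a / (a + b) ≤ 1 := by rw [div_le_one hab]; linarith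
  have hsm : r = 1 → φ (1 + b / (a + b)) + φ (1 - a / (a + b)) = 2 := by
    rintro rfl
    rw [hR _ hs0, hL _ ht0 ht1, Real.rpow_one, Real.rpow_one]
    field_simp; ring
  let v : Bool → ℝ := fun i => if i then 1 + b / (a + b) else 1 - a / (a + b)
  let w : Bool → ℝ := fun i => if i then 1 - a / (a + b) else 1 + b / (a + b)
  have hv : ∀ i, 0 ≤ v i := by intro i; cases i <;> simp [v] <;> linarith
  have hw : ∀ i, 0 ≤ w i := by intro i; cases i <;> simp [w] <;> linarith
  have hv' : r = 1 → ∑ i, P.real (d ⁻¹' {i}) * φ (v i) = 1 := by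
    intro h
    simp only [Fintype.sum_bool, hqt, hqf, v, if_true, Bool.false_eq_true, if_false]
    linarith [hsm h]
  have hw' : r = 1 → ∑ i, P.real (d ⁻¹' {i}) * φ (w i) = 1 := by
    intro h
    simp only [Fintype.sum_bool, hqt, hqf, w, if_true, Bool.false_eq_true, if_false]
    linarith [hsm h]
  have hmid : ∑ i, P.real (d ⁻¹' {i}) * φ ((v i + w i) / 2)
      = φ (1 + (b - a) / (2 * (a + b))) := by
    have e1 : (1 + b / (a + b) + (1 - a / (a + b))) / 2 = 1 + (b - a) / (2 * (a + b)) := by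
      field_simp; ring
    have e2 : (1 - a / (a + b) + (1 + b / (a + b))) / 2 = 1 + (b - a) / (2 * (a + b)) := by
      field_simp; ring
    simp only [Fintype.sum_bool, hqt, hqf, v, w, if_true, Bool.false_eq_true, if_false]
    rw [e1, e2]; ring
  have hm0 : 0 ≤ 1 + (b - a) / (2 * (a + b)) := by
    have : 1 + (b - a) / (2 * (a + b)) = (a + 3 * b) / (2 * (a + b)) := by field_simp; ring
    rw [this]; positivity
  constructor
  · intro hcv
    have i1 := aux_convex hr hcv c hc v1 w1 hv1 hw1 hv1' hw1'
    have i2 := aux_convex hr hcv c hc v2 w2 hv2 hw2 hv2' hw2'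
    rw [hE1] at i1
    rw [hE2] at i2
    have hr1 : r = 1 := r1 (by
      apply le_antisymm <;> nlinarith)
    refine ⟨a, b, hb, ?_, fin hr1⟩
    have i3 := aux_convex hr hcv d hd v w hv hw (hv' hr1) (hw' hr1)
    replace i3 := (hmid.symm.le.trans i3).trans hr.one.ge
    rw [hr.strict.le_iff_le hm0 (Set.mem_Ici.2 zero_le_one)] at i3
    have i4 : (b - a) / (2 * (a + b)) ≤ 0 := by linarith
    rw [div_le_iff₀ (by linarith)] at i4
    linarith
  · intro hcv
    have i1 := aux_concave hr hcv c hc v1 w1 hv1 hw1 hv1' hw1'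
    have i2 := aux_concave hr hcv c hc v2 w2 hv2 hw2 hv2' hw2'
    rw [hE1] at i1
    rw [hE2] at i2
    have hr1 : r = 1 := r1 (by
      apply le_antisymm <;> nlinarith)
    refine ⟨a, b, ha, ?_, fin hr1⟩
    have i3 := aux_concave hr hcv d hd v w hv hw (hv' hr1) (hw' hr1)
    replace i3 := (hr.one.le.trans i3).trans hmid.le
    rw [hr.strict.le_iff_le (Set.mem_Ici.2 zero_le_one) hm0] at i3
    have i4 : 0 ≤ (b - a) / (2 * (a + b)) := by linarith
    rw [le_div_iff₀ (by linarith)] at i4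
    linarith
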